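/- arXiv:2403.16398 — 2 statements merged into one kernel-verified Lean document; each statement's English description precedes it below -/
import Mathlib

section
/- Let G be a real K × m matrix and let Δ_K = {z ∈ ℝ^K : z_i ≥ 0 for all i, Σ_i z_i = 1} be the probability simplex. Then sup_{d ∈ ℝ^m} inf_{z ∈ Δ_K} ( ⟨Gᵀ z, d⟩ − (1/2)‖d‖² ) = inf_{z ∈ Δ_K} (1/2)‖Gᵀ z‖², i.e. the dual form of the balanced-rate maximization problem is the minimum over the simplex of half the squared norm of Gᵀz, and the duality gap is zero (Proposition 3.2). -/
open scoped RealInnerProductSpace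

/-- A nonempty complete convex set has a point `v` such that every point of the set has inner
product at least `‖v‖ ^ 2` with `v`, namely its point of minimal norm. -/
theorem Convex.exists_mem_forall_norm_sq_le_inner {E : Type*} [NormedAddCommGroup E]
    [InnerProductSpace ℝ E] {S : Set E} (hne : S.Nonempty) (hc : IsComplete S)
    (hS : Convex ℝ S) : ∃ v ∈ S, ∀ w ∈ S, ‖v‖ ^ 2 ≤ ⟪v, w⟫ := by
  obtain ⟨v, hv, hmin⟩ := exists_norm_eq_iInf_of_complete_convex hne hc hS 0
  refine ⟨v, hv, fun w hw => ?_⟩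
  have h := (norm_eq_iInf_iff_real_inner_le_zero hS hv).1 hmin w hw
  rw [zero_sub, inner_neg_left, inner_sub_right, real_inner_self_eq_norm_sq] at h
  linarith

/-- Minimax duality for the regularized bilinear problem over a family of vectors whose range is
nonempty, compact and convex. -/
theorem iSup_iInf_inner_sub_half_norm_sq {ι E : Type*} [NormedAddCommGroup E]
    [InnerProductSpace ℝ E] [Nonempty ι] (f : ι → E) (hcomp : IsCompact (Set.range f))
    (hconv : Convex ℝ (Set.range f)) :
    (⨆ d : E, ⨅ z, (⟪f z, d⟫ - (1/2) * ‖d‖^2)) = ⨅ z, (1/2) * ‖f z‖^2 := by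
  obtain ⟨_, ⟨z₀, rfl⟩, hinner⟩ :=
    Convex.exists_mem_forall_norm_sq_le_inner (Set.range_nonempty f) hcomp.isComplete hconv
  have hbdd (d : E) : BddBelow (Set.range fun z => ⟪f z, d⟫ - (1/2) * ‖d‖^2) := by
    have := hcomp.bddBelow_image (f := fun w => ⟪w, d⟫ - (1/2) * ‖d‖^2) (by fun_prop)
    rwa [← Set.range_comp] at this
  have hupper (d : E) : (⨅ z, (⟪f z, d⟫ - (1/2) * ‖d‖^2)) ≤ (1/2) * ‖f z₀‖^2 := by
    refine (ciInf_le (hbdd d) z₀).trans ?_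
    have := norm_sub_sq_real (f z₀) d
    nlinarith [sq_nonneg ‖f z₀ - d‖]
  have hlower : (1/2) * ‖f z₀‖^2 ≤ ⨅ z, (⟪f z, f z₀⟫ - (1/2) * ‖f z₀‖^2) := by
    refine le_ciInf fun z => ?_
    have := hinner (f z) ⟨z, rfl⟩
    rw [real_inner_comm] at this
    linarith
  have hdual : (⨅ z, (1/2) * ‖f z‖^2) = (1/2) * ‖f z₀‖^2 := by
    refine le_antisymm (ciInf_le ⟨0, Set.forall_mem_range.2 fun z => by positivity⟩ z₀)
      (le_ciInf fun z => ?_)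
    have := hinner (f z) ⟨z, rfl⟩
    have := norm_sub_sq_real (f z₀) (f z)
    nlinarith [sq_nonneg ‖f z₀ - f z‖]
  rw [hdual]
  exact le_antisymm (ciSup_le hupper)
    (hlower.trans (le_ciSup (f := fun d => ⨅ z, (⟪f z, d⟫ - (1/2) * ‖d‖^2))
      ⟨_, Set.forall_mem_range.2 hupper⟩ (f z₀)))

/-- Duality with zero gap (Proposition 3.2): for a real `K × m` matrix `G` (given by its rows
`G i ∈ ℝ^m`) and the probability simplex `Δ_K`,
`sup_d inf_{z ∈ Δ_K} (⟪Gᵀz, d⟫ - (1/2)‖d‖²) = inf_{z ∈ Δ_K} (1/2)‖Gᵀz‖²`,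
where `Gᵀ z = ∑ i, z i • G i`. -/
theorem stmt1 (K m : ℕ) (hK : 0 < K) (G : Fin K → EuclideanSpace ℝ (Fin m)) :
    (⨆ d : EuclideanSpace ℝ (Fin m),
        ⨅ z : {z : Fin K → ℝ // (∀ i, 0 ≤ z i) ∧ ∑ i, z i = 1},
          (⟪∑ i, z.1 i • G i, d⟫ - (1/2) * ‖d‖^2)) =
      ⨅ z : {z : Fin K → ℝ // (∀ i, 0 ≤ z i) ∧ ∑ i, z i = 1},
        (1/2) * ‖∑ i, z.1 i • G i‖^2 := by
  have hrange : Set.range (fun z : {z : Fin K → ℝ // (∀ i, 0 ≤ z i) ∧ ∑ i, z i = 1} =>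
      ∑ i, z.1 i • G i) = Fintype.linearCombination ℝ G '' stdSimplex ℝ (Fin K) := by
    ext w
    simp [stdSimplex, Fintype.linearCombination_apply]
  have : Nonempty {z : Fin K → ℝ // (∀ i, 0 ≤ z i) ∧ ∑ i, z i = 1} :=
    ⟨⟨Pi.single ⟨0, hK⟩ 1, single_mem_stdSimplex ℝ _⟩⟩
  refine iSup_iInf_inner_sub_half_norm_sq _ ?_ ?_
  · rw [hrange]
    exact (isCompact_stdSimplex ℝ (Fin K)).image (LinearMap.continuous_of_finiteDimensional _)
  · rw [hrange]
    exact (convex_stdSimplex ℝ (Fin K)).linear_image _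
end

section
/- Let G be a real K × m matrix and Δ_K ⊂ ℝ^K the probability simplex. If z* ∈ Δ_K minimizes z ↦ (1/2)‖Gᵀ z‖² over Δ_K, then d* = Gᵀ z* is a maximizer of the function f(d) = min_{1 ≤ i ≤ K} ⟨G_i, d⟩ − (1/2)‖d‖² over ℝ^m (where G_i denotes the i-th row of G), and f(d*) = (1/2)‖Gᵀ z*‖². -/
open scoped RealInnerProductSpace

/-- First-order optimality: if the norm on the segment from `x` to `y` is minimal at `x`, then
`‖x‖ ^ 2 ≤ ⟪y, x⟫`. -/
theorem norm_sq_le_inner_of_forall_norm_le {E : Type*} [NormedAddCommGroup E]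
    [InnerProductSpace ℝ E] {x y : E}
    (h : ∀ t : ℝ, 0 ≤ t → t ≤ 1 → ‖x‖ ^ 2 ≤ ‖(1 - t) • x + t • y‖ ^ 2) :
    ‖x‖ ^ 2 ≤ ⟪y, x⟫ := by
  by_contra! hlt
  have hexp (t : ℝ) : ‖(1 - t) • x + t • y‖ ^ 2 =
      ‖x‖ ^ 2 + t * (2 * (⟪y, x⟫ - ‖x‖ ^ 2) + t * ‖y - x‖ ^ 2) := by
    rw [norm_add_sq_real, norm_sub_sq_real, norm_smul, norm_smul, mul_pow, mul_pow,
      real_inner_smul_left, real_inner_smul_right, real_inner_comm y x, Real.norm_eq_abs,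
      Real.norm_eq_abs, sq_abs, sq_abs]
    ring
  set a := ‖x‖ ^ 2 - ⟪y, x⟫ with ha
  set b := ‖y - x‖ ^ 2
  have ha0 : 0 < a := sub_pos.2 hlt
  have hb0 : 0 ≤ b := sq_nonneg _
  have hab : 0 < a + b := by positivity
  have ht0 : 0 < a / (a + b) := by positivity
  have ht1 : a / (a + b) ≤ 1 := (div_le_one hab).2 (by linarith)
  have hta : a / (a + b) * b ≤ a := by
    rw [div_mul_eq_mul_div, div_le_iff₀ hab]
    nlinarith
  have := h _ ht0.le ht1
  rw [hexp] at this
  nlinarith [mul_pos ht0 (show 0 < 2 * a - a / (a + b) * b by linarith)]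

/-- The infimum of a finite real family is at most any of its weighted averages. -/
theorem ciInf_le_sum_mul {ι : Type*} [Fintype ι] {w : ι → ℝ} (f : ι → ℝ)
    (hw0 : ∀ i, 0 ≤ w i) (hw1 : ∑ i, w i = 1) : ⨅ i, f i ≤ ∑ i, w i * f i :=
  calc ⨅ i, f i = ∑ i, w i * ⨅ i, f i := by rw [← Finset.sum_mul, hw1, one_mul]
    _ ≤ ∑ i, w i * f i := Finset.sum_le_sum fun i _ =>
      mul_le_mul_of_nonneg_left (ciInf_le (Set.finite_range f).bddBelow i) (hw0 i)

/-- If `z* ∈ Δ_K` minimizes `z ↦ (1/2)‖Gᵀz‖²` over the probability simplex, then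
`d* = Gᵀ z* = ∑ i, z* i • G i` maximizes `f(d) = min_i ⟪G i, d⟫ - (1/2)‖d‖²` over `ℝ^m`,
and `f(d*) = (1/2)‖Gᵀ z*‖²`. -/
theorem stmt2 (K m : ℕ) (hK : 0 < K) (G : Fin K → EuclideanSpace ℝ (Fin m))
    (zs : Fin K → ℝ) (hzs0 : ∀ i, 0 ≤ zs i) (hzs1 : ∑ i, zs i = 1)
    (hmin : ∀ z : Fin K → ℝ, (∀ i, 0 ≤ z i) → ∑ i, z i = 1 →
      (1/2) * ‖∑ i, zs i • G i‖^2 ≤ (1/2) * ‖∑ i, z i • G i‖^2) :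
    (∀ d : EuclideanSpace ℝ (Fin m),
        (⨅ i, ⟪G i, d⟫) - (1/2) * ‖d‖^2 ≤
          (⨅ i, ⟪G i, ∑ j, zs j • G j⟫) - (1/2) * ‖∑ j, zs j • G j‖^2) ∧
    (⨅ i, ⟪G i, ∑ j, zs j • G j⟫) - (1/2) * ‖∑ j, zs j • G j‖^2 =
      (1/2) * ‖∑ j, zs j • G j‖^2 := by
  have : Nonempty (Fin K) := ⟨⟨0, hK⟩⟩
  have havg (d : EuclideanSpace ℝ (Fin m)) : ⨅ i, ⟪G i, d⟫ ≤ ⟪∑ j, zs j • G j, d⟫ := by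
    simpa only [sum_inner, real_inner_smul_left] using
      ciInf_le_sum_mul (fun i => ⟪G i, d⟫) hzs0 hzs1
  have hle (i : Fin K) : ‖∑ j, zs j • G j‖ ^ 2 ≤ ⟪G i, ∑ j, zs j • G j⟫ := by
    refine norm_sq_le_inner_of_forall_norm_le fun t ht0 ht1 => ?_
    have hz := hmin (fun j => (1 - t) * zs j + t * Pi.single (M := fun _ => ℝ) i 1 j)
      (fun j => add_nonneg (mul_nonneg (sub_nonneg.2 ht1) (hzs0 j))
        (mul_nonneg ht0 (by rw [Pi.single_apply]; split_ifs <;> norm_num)))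
      (by simp [Finset.sum_add_distrib, ← Finset.mul_sum, hzs1])
    have hsum : ∑ j, ((1 - t) * zs j + t * Pi.single (M := fun _ => ℝ) i 1 j) • G j =
        (1 - t) • ∑ j, zs j • G j + t • G i := by
      simp [add_smul, mul_smul, Finset.sum_add_distrib, ← Finset.smul_sum, Pi.single_apply]
    rw [hsum] at hz
    linarith
  have hinf : ⨅ i, ⟪G i, ∑ j, zs j • G j⟫ = ‖∑ j, zs j • G j‖ ^ 2 :=
    le_antisymm ((havg _).trans_eq (real_inner_self_eq_norm_sq _)) (le_ciInf hle)
  rw [hinf]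
  refine ⟨fun d => ?_, by ring⟩
  have hsq := sq_nonneg ‖∑ j, zs j • G j - d‖
  rw [norm_sub_sq_real] at hsq
  linarith [havg d]
end
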